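/- arXiv:1404.0667 — 3 statements merged into one kernel-verified Lean document; each statement's English description precedes it below -/
import Mathlib

section
/- For every δ > 0 and d ≥ 1, the wall function W_δ is a bijection from ℝ^d onto the open ball {y ∈ ℝ^d : ‖y‖ < 2δ}; moreover W_δ(0) = 0 and for every x ≠ 0 there is a scalar c > 0 with W_δ(x) = c·x (W_δ preserves the direction of every nonzero vector). -/
open Real

/-- The wall function `W_δ` on `ℝ^d`. -/
noncomputable def wallFun (δ : ℝ) {d : ℕ} (x : EuclideanSpace ℝ (Fin d)) :
    EuclideanSpace ℝ (Fin d) :=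
  if ‖x‖ ≤ 3 * δ / 2 then x
  else (2 * δ - δ / 2 * Real.exp (3 - (2 / δ) * ‖x‖)) • (‖x‖⁻¹ • x)

/-- The norm of `wallFun δ x` as a function of `‖x‖`, outside the ball of radius `3δ/2`. -/
noncomputable def wallProfile (δ r : ℝ) : ℝ :=
  2 * δ - δ / 2 * Real.exp (3 - (2 / δ) * r)

theorem wallProfile_lt {δ : ℝ} (hδ : 0 < δ) (r : ℝ) : wallProfile δ r < 2 * δ := by
  have : 0 < δ / 2 * Real.exp (3 - (2 / δ) * r) := by positivity
  unfold wallProfile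
  linarith

theorem wallProfile_strictMono {δ : ℝ} (hδ : 0 < δ) : StrictMono (wallProfile δ) := by
  intro r s hrs
  unfold wallProfile
  gcongr

theorem wallProfile_three_mul_div_two {δ : ℝ} (hδ : 0 < δ) :
    wallProfile δ (3 * δ / 2) = 3 * δ / 2 := by
  have h : 3 - (2 / δ) * (3 * δ / 2) = 0 := by field_simp; ring
  rw [wallProfile, h, Real.exp_zero]
  ring

theorem exists_wallProfile_eq {δ t : ℝ} (hδ : 0 < δ) (ht : t < 2 * δ) :
    ∃ r, wallProfile δ r = t := by
  have hpos : 0 < (2 * δ - t) / (δ / 2) := div_pos (by linarith) (by linarith)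
  refine ⟨δ / 2 * (3 - Real.log ((2 * δ - t) / (δ / 2))), ?_⟩
  have h : 3 - (2 / δ) * (δ / 2 * (3 - Real.log ((2 * δ - t) / (δ / 2)))) =
      Real.log ((2 * δ - t) / (δ / 2)) := by
    rw [← mul_assoc, div_mul_div_cancel₀ hδ.ne', div_self two_ne_zero]
    ring
  rw [wallProfile, h, Real.exp_log hpos, mul_div_cancel₀ _ (by positivity)]
  ring

theorem lt_wallProfile_iff {δ r : ℝ} (hδ : 0 < δ) :
    3 * δ / 2 < wallProfile δ r ↔ 3 * δ / 2 < r := by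
  conv_lhs => rw [← wallProfile_three_mul_div_two hδ]
  exact (wallProfile_strictMono hδ).lt_iff_lt

section

variable {δ : ℝ} {d : ℕ} {x : EuclideanSpace ℝ (Fin d)}

theorem wallFun_of_le (hx : ‖x‖ ≤ 3 * δ / 2) : wallFun δ x = x := if_pos hx

theorem wallFun_of_lt (hx : 3 * δ / 2 < ‖x‖) :
    wallFun δ x = (wallProfile δ ‖x‖ * ‖x‖⁻¹) • x := by
  rw [wallFun, if_neg hx.not_ge, smul_smul, wallProfile]

theorem norm_wallFun_of_lt (hδ : 0 < δ) (hx : 3 * δ / 2 < ‖x‖) :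
    ‖wallFun δ x‖ = wallProfile δ ‖x‖ := by
  have hx0 : 0 < ‖x‖ := by linarith
  have hp : 0 < wallProfile δ ‖x‖ := by linarith [(lt_wallProfile_iff hδ).2 hx]
  rw [wallFun_of_lt hx, norm_smul, Real.norm_of_nonneg (by positivity),
    inv_mul_cancel_right₀ hx0.ne']

theorem exists_pos_wallFun_eq_smul (hδ : 0 < δ) (x : EuclideanSpace ℝ (Fin d)) :
    ∃ c : ℝ, 0 < c ∧ wallFun δ x = c • x := by
  rcases le_or_gt ‖x‖ (3 * δ / 2) with hx | hx
  · exact ⟨1, one_pos, by rw [wallFun_of_le hx, one_smul]⟩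
  · have hx0 : 0 < ‖x‖ := by linarith
    have hp : 0 < wallProfile δ ‖x‖ := by linarith [(lt_wallProfile_iff hδ).2 hx]
    exact ⟨_, by positivity, wallFun_of_lt hx⟩

theorem norm_wallFun_lt (hδ : 0 < δ) (x : EuclideanSpace ℝ (Fin d)) :
    ‖wallFun δ x‖ < 2 * δ := by
  rcases le_or_gt ‖x‖ (3 * δ / 2) with hx | hx
  · rw [wallFun_of_le hx]
    linarith
  · rw [norm_wallFun_of_lt hδ hx]
    exact wallProfile_lt hδ _

theorem norm_wallFun_le_iff (hδ : 0 < δ) :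
    ‖wallFun δ x‖ ≤ 3 * δ / 2 ↔ ‖x‖ ≤ 3 * δ / 2 := by
  rcases le_or_gt ‖x‖ (3 * δ / 2) with hx | hx
  · rw [wallFun_of_le hx]
  · rw [norm_wallFun_of_lt hδ hx, ← not_lt, lt_wallProfile_iff hδ, not_lt]

theorem wallFun_injective (hδ : 0 < δ) :
    Function.Injective (wallFun δ : EuclideanSpace ℝ (Fin d) → _) := by
  intro x y hxy
  have hiff : ‖x‖ ≤ 3 * δ / 2 ↔ ‖y‖ ≤ 3 * δ / 2 := by
    rw [← norm_wallFun_le_iff hδ, hxy, norm_wallFun_le_iff hδ]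
  rcases le_or_gt ‖x‖ (3 * δ / 2) with hx | hx
  · rwa [wallFun_of_le hx, wallFun_of_le (hiff.1 hx)] at hxy
  · have hy : 3 * δ / 2 < ‖y‖ := not_le.1 (mt hiff.2 hx.not_ge)
    have hnorm : ‖x‖ = ‖y‖ := (wallProfile_strictMono hδ).injective <| by
      rw [← norm_wallFun_of_lt hδ hx, hxy, norm_wallFun_of_lt hδ hy]
    have hy0 : 0 < ‖y‖ := by linarith
    have hp : 0 < wallProfile δ ‖y‖ := by linarith [(lt_wallProfile_iff hδ).2 hy]
    rw [wallFun_of_lt hx, wallFun_of_lt hy, hnorm] at hxy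
    exact smul_right_injective _ (by positivity) hxy

theorem exists_wallFun_eq (hδ : 0 < δ) {y : EuclideanSpace ℝ (Fin d)} (hy : ‖y‖ < 2 * δ) :
    ∃ x, wallFun δ x = y := by
  rcases le_or_gt ‖y‖ (3 * δ / 2) with hle | hlt
  · exact ⟨y, wallFun_of_le hle⟩
  · obtain ⟨r, hr⟩ := exists_wallProfile_eq hδ hy
    have hrlt : 3 * δ / 2 < r := (lt_wallProfile_iff hδ).1 (hr ▸ hlt)
    have hr0 : 0 < r := by linarith
    have hy0 : 0 < ‖y‖ := by linarith
    have hnorm : ‖(r * ‖y‖⁻¹) • y‖ = r := by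
      rw [norm_smul, Real.norm_of_nonneg (by positivity), inv_mul_cancel_right₀ hy0.ne']
    refine ⟨(r * ‖y‖⁻¹) • y, ?_⟩
    rw [wallFun_of_lt (by rwa [hnorm]), hnorm, hr, smul_smul]
    have h : ‖y‖ * r⁻¹ * (r * ‖y‖⁻¹) = 1 := by field_simp
    rw [h, one_smul]

end

/-- For every `δ > 0` and `d ≥ 1`, the wall function is a bijection from `ℝ^d` onto the
open ball `{y : ‖y‖ < 2δ}`; moreover `W_δ(0) = 0` and every nonzero `x` is mapped to a
positive scalar multiple of itself (the direction is preserved). -/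
theorem wallFun_bijOn_ball (δ : ℝ) (hδ : 0 < δ) (d : ℕ) (hd : 1 ≤ d) :
    Set.BijOn (wallFun δ) (Set.univ : Set (EuclideanSpace ℝ (Fin d)))
      (Metric.ball (0 : EuclideanSpace ℝ (Fin d)) (2 * δ)) ∧
    wallFun δ (0 : EuclideanSpace ℝ (Fin d)) = 0 ∧
    ∀ x : EuclideanSpace ℝ (Fin d), x ≠ 0 → ∃ c : ℝ, 0 < c ∧ wallFun δ x = c • x := by
  refine ⟨⟨fun x _ => ?_, (wallFun_injective hδ).injOn, fun y hy => ?_⟩, ?_, fun x _ =>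
    exists_pos_wallFun_eq_smul hδ x⟩
  · exact mem_ball_zero_iff.2 (norm_wallFun_lt hδ x)
  · obtain ⟨x, hx⟩ := exists_wallFun_eq hδ (mem_ball_zero_iff.1 hy)
    exact ⟨x, Set.mem_univ x, hx⟩
  · exact wallFun_of_le (by rw [norm_zero]; positivity)
end

section
/- There exists a constant C > 0, independent of δ, d and x (for instance C = 10 works), such that for every δ > 0, d ≥ 1, and every x ∈ ℝ^d with ‖x‖ > 3δ/2, the wall function W_δ is twice differentiable at x and the second derivative D²W_δ(x), viewed as a bilinear map from ℝ^d × ℝ^d to ℝ^d, has operator norm at most C/δ. -/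
open Real

section Radial

variable {E : Type*} [NormedAddCommGroup E] [InnerProductSpace ℝ E]

theorem hasFDerivAt_norm_of_ne_zero {x : E} (hx : x ≠ 0) :
    HasFDerivAt (fun y : E => ‖y‖) (‖x‖⁻¹ • innerSL ℝ x) x := by
  have hr : ‖x‖ ≠ 0 := norm_ne_zero_iff.mpr hx
  have h := (hasStrictFDerivAt_norm_sq x).hasFDerivAt.sqrt (pow_ne_zero 2 hr)
  simp only [Real.sqrt_sq (norm_nonneg _)] at h
  refine h.congr_fderiv ?_
  ext v
  simp only [smul_apply, smul_eq_mul, nsmul_eq_mul, Nat.cast_ofNat]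
  field_simp

theorem hasFDerivAt_comp_norm {φ : ℝ → ℝ} {φ' : ℝ} {x : E} (hx : x ≠ 0)
    (hφ : HasDerivAt φ φ' ‖x‖) :
    HasFDerivAt (fun y : E => φ ‖y‖) ((φ' / ‖x‖) • innerSL ℝ x) x := by
  refine (hφ.comp_hasFDerivAt x (hasFDerivAt_norm_of_ne_zero hx)).congr_fderiv ?_
  rw [smul_smul, div_eq_mul_inv]

theorem hasFDerivAt_radial {φ : ℝ → ℝ} {φ' : ℝ} {x : E} (hx : x ≠ 0)
    (hφ : HasDerivAt φ φ' ‖x‖) :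
    HasFDerivAt (fun y : E => φ ‖y‖ • y)
      (φ ‖x‖ • ContinuousLinearMap.id ℝ E + (φ' / ‖x‖) • (innerSL ℝ x).smulRight x) x := by
  refine ((hasFDerivAt_comp_norm hx hφ).smul (hasFDerivAt_id x)).congr_fderiv ?_
  ext v
  simp [smul_smul]

theorem norm_fderiv_fderiv_radial_le {φ φ' : ℝ → ℝ} {φ'' : ℝ} {x : E} (hx : x ≠ 0)
    (hφ : ∀ᶠ s in nhds ‖x‖, HasDerivAt φ (φ' s) s) (hφ' : HasDerivAt φ' φ'' ‖x‖) :
    ‖fderiv ℝ (fderiv ℝ fun y : E => φ ‖y‖ • y) x‖ ≤ 4 * |φ' ‖x‖| + ‖x‖ * |φ''| := by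
  have hr : 0 < ‖x‖ := norm_pos_iff.mpr hx
  have hfirst : fderiv ℝ (fun y : E => φ ‖y‖ • y) =ᶠ[nhds x] fun y =>
      φ ‖y‖ • ContinuousLinearMap.id ℝ E +
        (φ' ‖y‖ / ‖y‖) • ContinuousLinearMap.smulRightL ℝ E E (innerSL ℝ y) y := by
    filter_upwards [continuous_norm.continuousAt.eventually hφ, eventually_ne_nhds hx]
      with y hy hy0
    exact (hasFDerivAt_radial hy0 hy).fderiv
  rw [hfirst.fderiv_eq]
  have hψ := hφ'.div (hasDerivAt_id ‖x‖) hr.ne'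
  have hB := (ContinuousLinearMap.smulRightL ℝ E E).hasFDerivAt_of_bilinear
    (innerSL ℝ (E := E)).hasFDerivAt (hasFDerivAt_id x)
  have hsecond := ((hasFDerivAt_comp_norm hx hφ.self_of_nhds).smul
    (hasFDerivAt_const (ContinuousLinearMap.id ℝ E) x)).add
      ((hasFDerivAt_comp_norm hx hψ).smul hB)
  refine (congrArg norm hsecond.fderiv).trans_le ?_
  refine ContinuousLinearMap.opNorm_le_bound _ (by positivity) fun v => ?_
  have hv : |inner ℝ x v| ≤ ‖x‖ * ‖v‖ := abs_real_inner_le_norm x v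
  have h1 : ‖(φ' ‖x‖ / ‖x‖ * inner ℝ x v) • ContinuousLinearMap.id ℝ E‖ ≤ |φ' ‖x‖| * ‖v‖ := by
    rw [norm_smul, Real.norm_eq_abs, abs_mul, abs_div, abs_norm]
    calc _ ≤ |φ' ‖x‖| / ‖x‖ * (‖x‖ * ‖v‖) * 1 := by
          gcongr
          exact ContinuousLinearMap.norm_id_le
      _ = _ := by field_simp
  have h2 : ‖((φ'' * ‖x‖ - φ' ‖x‖) / ‖x‖ ^ 2 / ‖x‖ * inner ℝ x v) • (innerSL ℝ x).smulRight x‖ ≤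
      (‖x‖ * |φ''| + |φ' ‖x‖|) * ‖v‖ := by
    rw [norm_smul, Real.norm_eq_abs, abs_mul, abs_div, abs_div, abs_pow, abs_norm,
      ContinuousLinearMap.norm_smulRight_apply, innerSL_apply_norm]
    have habs : |φ'' * ‖x‖ - φ' ‖x‖| ≤ ‖x‖ * |φ''| + |φ' ‖x‖| := by
      refine (abs_sub _ _).trans_eq ?_
      rw [abs_mul, abs_norm, mul_comm]
    calc _ ≤ (‖x‖ * |φ''| + |φ' ‖x‖|) / ‖x‖ ^ 2 / ‖x‖ * (‖x‖ * ‖v‖) * (‖x‖ * ‖x‖) := by gcongr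
      _ = _ := by field_simp
  have h3 : ‖(φ' ‖x‖ / ‖x‖) • ((innerSL ℝ x).smulRight v + (innerSL ℝ v).smulRight x)‖ ≤
      2 * |φ' ‖x‖| * ‖v‖ := by
    rw [norm_smul, Real.norm_eq_abs, abs_div, abs_norm]
    calc _ ≤ |φ' ‖x‖| / ‖x‖ * (‖x‖ * ‖v‖ + ‖v‖ * ‖x‖) := by
          gcongr
          refine (norm_add_le _ _).trans_eq ?_
          simp only [ContinuousLinearMap.norm_smulRight_apply, innerSL_apply_norm]
      _ = _ := by field_simp; ring
  calc _ = ‖(φ' ‖x‖ / ‖x‖ * inner ℝ x v) • ContinuousLinearMap.id ℝ E +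
        ((φ'' * ‖x‖ - φ' ‖x‖) / ‖x‖ ^ 2 / ‖x‖ * inner ℝ x v) • (innerSL ℝ x).smulRight x +
        (φ' ‖x‖ / ‖x‖) • ((innerSL ℝ x).smulRight v + (innerSL ℝ v).smulRight x)‖ := by
        congr 1
        ext w
        simp [smul_smul]
        rw [innerSL_apply_apply, innerSL_apply_apply]
        module
    _ ≤ _ := (norm_add₃_le).trans (add_le_add_three h1 h2 h3)
    _ = _ := by ring

end Radial

/-- The radial factor `g` with `wallFun δ x = g ‖x‖ • x` outside the ball of radius `3δ/2`. -/
noncomputable def wallFactor (δ r : ℝ) : ℝ :=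
  (2 * δ - δ / 2 * exp (3 - 2 / δ * r)) * r⁻¹

/-- The derivative of `wallFactor δ`. -/
noncomputable def wallFactorDeriv (δ r : ℝ) : ℝ :=
  exp (3 - 2 / δ * r) * r⁻¹ - (2 * δ - δ / 2 * exp (3 - 2 / δ * r)) * (r ^ 2)⁻¹

theorem hasDerivAt_exp_wall (δ r : ℝ) :
    HasDerivAt (fun s => exp (3 - 2 / δ * s)) (-(2 / δ) * exp (3 - 2 / δ * r)) r := by
  have h := (((hasDerivAt_id r).const_mul (2 / δ)).const_sub 3).exp
  refine h.congr_deriv ?_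
  simp only [id, mul_one]
  ring

theorem hasDerivAt_wallProfile {δ : ℝ} (hδ : δ ≠ 0) (r : ℝ) :
    HasDerivAt (fun s => 2 * δ - δ / 2 * exp (3 - 2 / δ * s)) (exp (3 - 2 / δ * r)) r := by
  refine (((hasDerivAt_exp_wall δ r).const_mul (δ / 2)).const_sub (2 * δ)).congr_deriv ?_
  field_simp

theorem hasDerivAt_wallFactor {δ r : ℝ} (hδ : δ ≠ 0) (hr : r ≠ 0) :
    HasDerivAt (wallFactor δ) (wallFactorDeriv δ r) r := by
  refine ((hasDerivAt_wallProfile hδ r).mul (hasDerivAt_inv hr)).congr_deriv ?_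
  rw [wallFactorDeriv]
  ring

theorem hasDerivAt_wallFactorDeriv {δ r : ℝ} (hδ : δ ≠ 0) (hr : r ≠ 0) :
    HasDerivAt (wallFactorDeriv δ)
      (-(2 / δ) * exp (3 - 2 / δ * r) * r⁻¹ - 2 * exp (3 - 2 / δ * r) * (r ^ 2)⁻¹ +
        2 * (2 * δ - δ / 2 * exp (3 - 2 / δ * r)) * (r ^ 3)⁻¹) r := by
  have hsq := (hasDerivAt_pow 2 r).inv (pow_ne_zero 2 hr)
  refine (((hasDerivAt_exp_wall δ r).mul (hasDerivAt_inv hr)).sub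
    ((hasDerivAt_wallProfile hδ r).mul hsq)).congr_deriv ?_
  simp only [Pi.inv_apply]
  field_simp
  ring

/-- There is a constant `C > 0`, independent of `δ`, `d` and `x`, such that for every
`δ > 0`, `d ≥ 1`, and `x` with `‖x‖ > 3δ/2`, the wall function is twice differentiable
at `x` and its second derivative, as a (curried) bilinear map `ℝ^d × ℝ^d → ℝ^d`, has
operator norm at most `C/δ`. -/
theorem wallFun_second_deriv_bound :
    ∃ C : ℝ, 0 < C ∧
      ∀ (δ : ℝ), 0 < δ → ∀ (d : ℕ), 1 ≤ d → ∀ x : EuclideanSpace ℝ (Fin d),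
        3 * δ / 2 < ‖x‖ →
          ContDiffAt ℝ 2 (wallFun δ) x ∧
          ‖fderiv ℝ (fderiv ℝ (wallFun δ)) x‖ ≤ C / δ := by
  refine ⟨12, by norm_num, fun δ hδ d _ x hx => ?_⟩
  have hr : 0 < ‖x‖ := by linarith
  have hx0 : x ≠ 0 := norm_pos_iff.mp hr
  have heq : wallFun δ =ᶠ[nhds x] fun y => wallFactor δ ‖y‖ • y := by
    filter_upwards [continuous_norm.continuousAt.eventually (lt_mem_nhds hx)] with y hy
    rw [wallFun, if_neg (not_le.mpr hy), smul_smul, wallFactor]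
  constructor
  · refine ContDiffAt.congr_of_eventuallyEq ?_ heq
    have hn : ContDiffAt ℝ 2 (fun y : EuclideanSpace ℝ (Fin d) => ‖y‖) x := contDiffAt_norm ℝ hx0
    exact ((contDiffAt_const.sub (contDiffAt_const.mul
      (contDiffAt_const.sub (contDiffAt_const.mul hn)).exp)).mul (hn.inv hr.ne')).smul contDiffAt_id
  rw [heq.fderiv.fderiv_eq]
  refine (norm_fderiv_fderiv_radial_le hx0
    ((eventually_ne_nhds hr.ne').mono fun s hs => hasDerivAt_wallFactor hδ.ne' hs)
    (hasDerivAt_wallFactorDeriv hδ.ne' hr.ne')).trans ?_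
  rw [wallFactorDeriv]
  generalize ‖x‖ = r at hx hr
  have he0 : 0 < exp (3 - 2 / δ * r) := exp_pos _
  have he1 : exp (3 - 2 / δ * r) ≤ 1 := by
    rw [exp_le_one_iff, sub_nonpos, div_mul_eq_mul_div, le_div_iff₀ hδ]
    linarith
  generalize exp (3 - 2 / δ * r) = e at he0 he1
  have hp0 : 0 ≤ 2 * δ - δ / 2 * e := by nlinarith
  have hp1 : 2 * δ - δ / 2 * e ≤ 2 * δ := by nlinarith
  generalize 2 * δ - δ / 2 * e = p at hp0 hp1
  have hinv : r⁻¹ ≤ 2 / 3 * δ⁻¹ := by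
    rw [inv_le_comm₀ hr (by positivity)]
    refine le_trans (le_of_eq ?_) hx.le
    field_simp
  have hi0 : 0 < r⁻¹ := inv_pos.mpr hr
  have hpinv : p * r⁻¹ ≤ 4 / 3 := by
    calc p * r⁻¹ ≤ 2 * δ * (2 / 3 * δ⁻¹) := by gcongr
      _ = 4 / 3 := by field_simp; norm_num
  have hpinv0 : 0 ≤ p * r⁻¹ := by positivity
  have hdi : 0 < δ⁻¹ := inv_pos.mpr hδ
  have h1 : |e * r⁻¹ - p * (r ^ 2)⁻¹| ≤ 14 / 9 * δ⁻¹ := by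
    have hfac : e * r⁻¹ - p * (r ^ 2)⁻¹ = (e - p * r⁻¹) * r⁻¹ := by field_simp
    have hb : |e - p * r⁻¹| ≤ 7 / 3 := abs_le.mpr ⟨by linarith, by linarith⟩
    rw [hfac, abs_mul, abs_of_pos hi0]
    calc _ ≤ 7 / 3 * (2 / 3 * δ⁻¹) := by gcongr
      _ = _ := by ring
  have h2 : r * |-(2 / δ) * e * r⁻¹ - 2 * e * (r ^ 2)⁻¹ + 2 * p * (r ^ 3)⁻¹| ≤
      46 / 9 * δ⁻¹ := by
    have hfac : r * (-(2 / δ) * e * r⁻¹ - 2 * e * (r ^ 2)⁻¹ + 2 * p * (r ^ 3)⁻¹) =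
        -(2 * (e * δ⁻¹)) - 2 * (e * r⁻¹) + 2 * (p * r⁻¹ * r⁻¹) := by field_simp
    have ha : e * δ⁻¹ ≤ 1 * δ⁻¹ := by gcongr
    have hb : e * r⁻¹ ≤ 1 * (2 / 3 * δ⁻¹) := by gcongr
    have hc : p * r⁻¹ * r⁻¹ ≤ 4 / 3 * (2 / 3 * δ⁻¹) := by gcongr
    have ha0 : 0 ≤ e * δ⁻¹ := by positivity
    have hb0 : 0 ≤ e * r⁻¹ := by positivity
    have hc0 : 0 ≤ p * r⁻¹ * r⁻¹ := by positivity
    rw [← abs_of_pos hr, ← abs_mul, abs_of_pos hr, hfac]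
    exact abs_le.mpr ⟨by linarith, by linarith⟩
  rw [div_eq_mul_inv 12]
  linarith
end

section
/- Let H be a real inner product space and let g : [0,∞) → [0,∞) be nondecreasing and 1-Lipschitz with g(0) = 0. Then the radial map F : H → H defined by F(0) = 0 and F(x) = g(‖x‖)·x/‖x‖ for x ≠ 0 is 1-Lipschitz: ‖F(x) − F(y)‖ ≤ ‖x − y‖ for all x, y ∈ H. -/
/-- Shrinking the lengths of two vectors, and the gap between the lengths, while keeping the
directions fixed does not increase the distance between the vectors. -/
theorem norm_smul_sub_smul_le_of_norm_eq_one {H : Type*} [NormedAddCommGroup H]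
    [InnerProductSpace ℝ H] {u v : H} (hu : ‖u‖ = 1) (hv : ‖v‖ = 1) {a b r s : ℝ}
    (ha : 0 ≤ a) (hb : 0 ≤ b) (har : a ≤ r) (hbs : b ≤ s) (hab : |a - b| ≤ |r - s|) :
    ‖a • u - b • v‖ ≤ ‖r • u - s • v‖ := by
  have norm_sq (p q : ℝ) :
      ‖p • u - q • v‖ ^ 2 = (p - q) ^ 2 + 2 * (p * q) * (1 - inner ℝ u v) := by
    rw [norm_sub_sq_real, norm_smul, norm_smul, hu, hv, real_inner_smul_left,
      real_inner_smul_right, mul_one, mul_one, Real.norm_eq_abs, Real.norm_eq_abs, sq_abs, sq_abs]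
    ring
  have hinner : inner ℝ u v ≤ 1 := by
    simpa [hu, hv] using real_inner_le_norm u v
  have hprod : a * b ≤ r * s := mul_le_mul har hbs hb (ha.trans har)
  refine (sq_le_sq₀ (norm_nonneg _) (norm_nonneg _)).mp ?_
  rw [norm_sq, norm_sq]
  have hsq : (a - b) ^ 2 ≤ (r - s) ^ 2 := sq_le_sq.mpr hab
  have hmul := mul_le_mul_of_nonneg_right hprod (sub_nonneg.mpr hinner)
  linarith

/-- Let `H` be a real inner product space and `g : [0,∞) → [0,∞)` be nondecreasing,
`1`-Lipschitz, with `g(0) = 0`. Then the radial map `F` with `F(0) = 0` and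
`F(x) = g(‖x‖)·x/‖x‖` for `x ≠ 0` is `1`-Lipschitz. -/
theorem radialMap_lipschitz {H : Type*} [NormedAddCommGroup H] [InnerProductSpace ℝ H]
    (g : ℝ → ℝ) (hmono : MonotoneOn g (Set.Ici 0))
    (hlip : LipschitzOnWith 1 g (Set.Ici 0))
    (hg0 : g 0 = 0) (hgnonneg : ∀ r ∈ Set.Ici (0 : ℝ), 0 ≤ g r)
    (F : H → H)
    (hF0 : F 0 = 0)
    (hF : ∀ x : H, x ≠ 0 → F x = g ‖x‖ • (‖x‖⁻¹ • x)) :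
    ∀ x y : H, ‖F x - F y‖ ≤ ‖x - y‖ := by
  have hdist (r s : ℝ) (hr : 0 ≤ r) (hs : 0 ≤ s) : |g r - g s| ≤ |r - s| := by
    simpa [Real.dist_eq] using hlip.dist_le_mul r hr s hs
  have hle (r : ℝ) (hr : 0 ≤ r) : g r ≤ r := by
    have h := hdist r 0 hr le_rfl
    rw [hg0, sub_zero, sub_zero, abs_of_nonneg hr] at h
    exact (le_abs_self _).trans h
  have hunit (x : H) (hx : x ≠ 0) : ‖‖x‖⁻¹ • x‖ = 1 := norm_smul_inv_norm (𝕜 := ℝ) hx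
  have hnorm (x : H) : ‖F x‖ ≤ ‖x‖ := by
    by_cases hx : x = 0
    · simp [hx, hF0]
    · rw [hF x hx, norm_smul, hunit x hx, mul_one, Real.norm_eq_abs,
        abs_of_nonneg (hgnonneg _ (norm_nonneg x))]
      exact hle _ (norm_nonneg x)
  intro x y
  by_cases hx : x = 0
  · simpa [hx, hF0] using hnorm y
  by_cases hy : y = 0
  · simpa [hy, hF0] using hnorm x
  rw [hF x hx, hF y hy]
  have h := norm_smul_sub_smul_le_of_norm_eq_one (hunit x hx) (hunit y hy)
    (hgnonneg _ (norm_nonneg x)) (hgnonneg _ (norm_nonneg y))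
    (hle _ (norm_nonneg x)) (hle _ (norm_nonneg y))
    (hdist _ _ (norm_nonneg x) (norm_nonneg y))
  rwa [smul_inv_smul₀ (norm_ne_zero_iff.mpr hx) x,
    smul_inv_smul₀ (norm_ne_zero_iff.mpr hy) y] at h
end
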